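/- arXiv:2412.15999 — 7 statements merged into one kernel-verified Lean document; each statement's English description precedes it below -/
import Mathlib

section
/- Let a ∈ (0,1) and β ∈ ℝ, and define the sequence (l_k) by l_0 = 1 and l_{k+1} = exp(β + a(l_k − 1)). Then: (i) if β > a − 1 − log a, the sequence l_k tends to +∞; (ii) if 0 ≤ β ≤ a − 1 − log a, the sequence (l_k) is nondecreasing and converges to the smallest fixed point of x ↦ exp(β + a(x − 1)) in [1, ∞), and this limit is at most 1/a; (iii) if β < 0 (which implies β ≤ a − 1 − log a), the sequence (l_k) is nonincreasing and converges to the largest fixed point of x ↦ exp(β + a(x − 1)) in (0, 1]. -/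
open Filter Real

/-- Below any point `y` with `f y ≤ y`, the iterates of a monotone `f` stay below `y`. -/
theorem Monotone.iterate_le_of_map_le_self {α : Type*} [Preorder α] {f : α → α}
    (hf : Monotone f) {x y : α} (hxy : x ≤ y) (hy : f y ≤ y) (k : ℕ) : f^[k] x ≤ y := by
  induction k with
  | zero => exact hxy
  | succ k ih =>
    rw [Function.iterate_succ_apply']
    exact (hf ih).trans hy

/-- The tangent line bound for `x ↦ exp (β + a (x - 1))` at `x = 1 / a`. -/
theorem exp_mul_le_exp_add_mul_sub_one {a : ℝ} (ha : 0 < a) (β x : ℝ) :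
    exp (β - (a - 1 - log a)) * x ≤ exp (β + a * (x - 1)) := by
  have hsplit : exp (β + a * (x - 1)) = exp (β - (a - 1 - log a)) * (exp (a * x - 1) / a) := by
    rw [show β - (a - 1 - log a) = β - a + 1 + log a by ring, exp_add _ (log a), exp_log ha,
      mul_assoc, mul_div_cancel₀ _ ha.ne', ← exp_add]
    ring_nf
  rw [hsplit]
  gcongr
  rw [le_div_iff₀ ha]
  linarith [add_one_le_exp (a * x - 1)]

/-- Behavior of the recursion `l₀ = 1`, `l_{k+1} = exp (β + a (l_k - 1))`
for `a ∈ (0,1)` and `β ∈ ℝ`. -/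
theorem stmt_0 (a β : ℝ) (ha : a ∈ Set.Ioo (0:ℝ) 1) (l : ℕ → ℝ)
    (hl0 : l 0 = 1) (hl : ∀ k, l (k + 1) = Real.exp (β + a * (l k - 1))) :
    (β > a - 1 - Real.log a → Tendsto l atTop atTop) ∧
    (0 ≤ β → β ≤ a - 1 - Real.log a →
      Monotone l ∧
      ∃ x : ℝ, IsLeast {y : ℝ | 1 ≤ y ∧ Real.exp (β + a * (y - 1)) = y} x ∧
        Tendsto l atTop (nhds x) ∧ x ≤ 1 / a) ∧
    (β < 0 →
      Antitone l ∧
      ∃ x : ℝ, IsGreatest {y : ℝ | 0 < y ∧ y ≤ 1 ∧ Real.exp (β + a * (y - 1)) = y} x ∧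
        Tendsto l atTop (nhds x)) := by
  obtain ⟨ha0, ha1⟩ := ha
  set f : ℝ → ℝ := fun x => exp (β + a * (x - 1)) with hf
  have hmono : Monotone f := fun x y hxy => by simp only [hf]; gcongr
  have hcont : Continuous f := by fun_prop
  have hiter : l = fun k => f^[k] 1 := by
    funext k
    induction k with
    | zero => exact hl0
    | succ k ih => rw [hl, Function.iterate_succ_apply', ← ih]
  have hf1 : f 1 = exp β := by simp [hf]
  have hfix : ∀ x, Tendsto l atTop (nhds x) → f x = x := fun x hx =>
    isFixedPt_of_tendsto_iterate (hiter ▸ hx) hcont.continuousAt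
  refine ⟨fun hβ => ?_, fun hβ0 hβ => ?_, fun hβ => ?_⟩
  · have hgrow : ∀ k, exp (β - (a - 1 - log a)) ^ k ≤ l k := by
      intro k
      induction k with
      | zero => simp [hl0]
      | succ k ih =>
        rw [hl, pow_succ']
        exact (mul_le_mul_of_nonneg_left ih (exp_pos _).le).trans
          (exp_mul_le_exp_add_mul_sub_one ha0 β (l k))
    exact tendsto_atTop_mono hgrow
      (tendsto_pow_atTop_atTop_of_one_lt (one_lt_exp_iff.mpr (sub_pos.mpr hβ)))
  · have hl_mono : Monotone l := by
      rw [hiter]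
      exact hmono.monotone_iterate_of_le_map (hf1 ▸ one_le_exp hβ0)
    have hbound : ∀ y, 1 ≤ y → f y ≤ y → ∀ k, l k ≤ y := fun y hy hfy k => by
      rw [hiter]
      exact hmono.iterate_le_of_map_le_self hy hfy k
    have hfa : f (1 / a) ≤ 1 / a := by
      have hexp : β + a * (1 / a - 1) ≤ -log a := by
        have : a * (1 / a - 1) = 1 - a := by field_simp
        linarith
      calc f (1 / a) ≤ exp (-log a) := exp_le_exp.mpr hexp
        _ = 1 / a := by rw [exp_neg, exp_log ha0, one_div]
    have hla := hbound (1 / a) (one_le_one_div ha0 ha1.le) hfa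
    have hlim := tendsto_atTop_ciSup hl_mono ⟨1 / a, Set.forall_mem_range.mpr hla⟩
    refine ⟨hl_mono, _, ⟨⟨?_, hfix _ hlim⟩, fun y hy => ?_⟩, hlim, le_of_tendsto' hlim hla⟩
    · exact hl0 ▸ hl_mono.ge_of_tendsto hlim 0
    · exact le_of_tendsto' hlim (hbound y hy.1 hy.2.le)
  · have hl_anti : Antitone l := by
      rw [hiter]
      exact hmono.antitone_iterate_of_map_le (hf1 ▸ exp_le_one_iff.mpr hβ.le)
    have hbound : ∀ y, y ≤ 1 → y ≤ f y → ∀ k, y ≤ l k := fun y hy hfy k => by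
      rw [hiter]
      exact hmono.dual.iterate_le_of_map_le_self (α := ℝᵒᵈ) hy hfy k
    have hlim := tendsto_atTop_ciInf hl_anti
      ⟨0, Set.forall_mem_range.mpr (hbound 0 zero_le_one (exp_pos _).le)⟩
    have hx := hfix _ hlim
    refine ⟨hl_anti, _, ⟨⟨?_, ?_, hx⟩, fun y hy => ?_⟩, hlim⟩
    · exact hx ▸ exp_pos _
    · exact hl0 ▸ hl_anti.le_of_tendsto hlim 0
    · exact ge_of_tendsto' hlim (hbound y hy.2.1 hy.2.2.ge)
end

section
/- Let (ε_n) be a sequence in (0,1) with ε_n → 0 and let δ ∈ [0,1). For each n set a_n = 1 − ε_n and β_n = ½(1 − δ)ε_n². Then β_n ≤ a_n − 1 − log a_n for every n, so the map x ↦ exp(β_n + a_n(x − 1)) has a smallest fixed point x_n in [1, ∞); moreover ε_n^{−1}(x_n − 1) → 1 − √δ as n → ∞. -/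
open Filter Real

theorem sq_half_le_neg_sub_log_one_sub {e : ℝ} (h0 : 0 ≤ e) (h1 : e < 1) :
    e ^ 2 / 2 ≤ -e - log (1 - e) := by
  have hs := hasSum_pow_div_log_of_abs_lt_one (abs_lt.2 ⟨by linarith, h1⟩)
  have h := sum_le_hasSum (Finset.range 2) (fun i _ => by positivity) hs
  norm_num [Finset.sum_range_succ] at h
  linarith

/-- The map `y ↦ exp (β + a (y - 1))` has a smallest fixed point in `[1, ∞)`, and it is
at most `1 / a`, the minimizer of `β + a (y - 1) - log y`. -/
theorem exists_isLeast_exp_fixedPoint {a β : ℝ} (ha0 : 0 < a) (ha1 : a ≤ 1) (hβ0 : 0 ≤ β)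
    (hβ : β ≤ a - 1 - log a) :
    ∃ x, IsLeast {y : ℝ | 1 ≤ y ∧ exp (β + a * (y - 1)) = y} x ∧ x ≤ 1 / a := by
  set S := {y : ℝ | 1 ≤ y ∧ exp (β + a * (y - 1)) = y}
  have hcont : Continuous fun y : ℝ => exp (β + a * (y - 1)) - y := by fun_prop
  have hle : (1 : ℝ) ≤ 1 / a := (one_le_div ha0).2 ha1
  have hright : exp (β + a * (1 / a - 1)) - 1 / a ≤ 0 := by
    have h : β + a * (1 / a - 1) ≤ log (1 / a) := by
      rw [one_div, log_inv, mul_sub, mul_inv_cancel₀ ha0.ne']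
      linarith
    have := exp_le_exp.2 h
    rw [exp_log (by positivity)] at this
    linarith
  have hleft : 0 ≤ exp (β + a * (1 - 1)) - 1 := by simpa using hβ0
  obtain ⟨y, ⟨hy1, hya⟩, hy⟩ :=
    intermediate_value_Icc' hle hcont.continuousOn ⟨hright, hleft⟩
  have hyS : y ∈ S := ⟨hy1, sub_eq_zero.1 hy⟩
  have hbdd : BddBelow S := ⟨1, fun _ hz => hz.1⟩
  have hclosed : IsClosed S :=
    isClosed_Ici.inter (isClosed_eq (by fun_prop) continuous_id)
  exact ⟨sInf S, hclosed.isLeast_csInf ⟨y, hyS⟩ hbdd, (csInf_le hbdd hyS).trans hya⟩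

theorem abs_sq_sub_le_of_exp_fixedPoint {e δ x : ℝ} (he0 : 0 < e) (he : e ≤ 1 / 3)
    (hx1 : 1 ≤ x) (hx : x ≤ 1 / (1 - e))
    (hfix : exp ((1 / 2) * (1 - δ) * e ^ 2 + (1 - e) * (x - 1)) = x) :
    |((x - 1) / e - 1) ^ 2 - δ| ≤ 14 * e := by
  obtain ⟨u, rfl⟩ : ∃ u, x = 1 + e * u := ⟨(x - 1) / e, by field_simp; ring⟩
  have hu0 : 0 ≤ u := nonneg_of_mul_nonneg_right (by linarith) he0
  have hu : u ≤ 3 / 2 := by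
    rw [le_div_iff₀ (by linarith)] at hx
    have h : u * (1 - e) ≤ 1 := by
      refine le_of_mul_le_mul_left ?_ he0
      linarith
    nlinarith
  have hz0 : 0 ≤ e * u := by positivity
  have hz : e * u ≤ 1 / 2 := by nlinarith
  have hlog : log (1 + e * u) = (1 / 2) * (1 - δ) * e ^ 2 + (1 - e) * (e * u) := by
    conv_lhs => rw [← hfix, log_exp]
    ring
  have hT := abs_log_sub_add_sum_range_le (x := -(e * u))
    (by rw [abs_neg, abs_of_nonneg hz0]; linarith) 2
  rw [abs_neg, abs_of_nonneg hz0, sub_neg_eq_add, hlog] at hT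
  norm_num [Finset.sum_range_succ] at hT
  have hR : (e * u) ^ 3 / (1 - e * u) ≤ 7 * e ^ 3 := by
    rw [div_le_iff₀ (by linarith), mul_pow]
    have hu3 : u ^ 3 ≤ (3 / 2) ^ 3 := by gcongr
    have he3 : 0 < e ^ 3 := by positivity
    nlinarith
  have hU : (1 + e * u - 1) / e = u := by field_simp; ring
  rw [hU]
  have hbound := hT.trans hR
  rw [abs_le] at hbound ⊢
  have he2 : 0 < e ^ 2 := by positivity
  constructor
  · refine le_of_mul_le_mul_left ?_ he2
    linarith [hbound.1]
  · refine le_of_mul_le_mul_left ?_ he2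
    linarith [hbound.2]

/-- The upper bounds `v n` with limit `1` select the smaller root of `(u - 1) ^ 2 = δ`. -/
theorem tendsto_one_sub_sqrt_of_sq_tendsto {ι : Type*} {l : Filter ι} {u v : ι → ℝ} {δ : ℝ}
    (hsq : Tendsto (fun n => (u n - 1) ^ 2) l (nhds δ)) (huv : ∀ n, u n ≤ v n)
    (hv : Tendsto v l (nhds 1)) : Tendsto u l (nhds (1 - √δ)) := by
  have habs : Tendsto (fun n => |u n - 1|) l (nhds √δ) := by
    simpa only [sqrt_sq_eq_abs] using hsq.sqrt
  have hmax : Tendsto (fun n => max (u n - 1) 0) l (nhds 0) := by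
    have h : Tendsto (fun n => max (v n - 1) 0) l (nhds 0) := by
      simpa using (hv.sub_const 1).max (tendsto_const_nhds (x := (0 : ℝ)))
    refine squeeze_zero (fun n => le_max_right _ _) (fun n => ?_) h
    gcongr
    exact huv n
  have h := ((tendsto_const_nhds (x := (1 : ℝ))).sub habs).add (hmax.const_mul 2)
  rw [mul_zero, add_zero] at h
  refine h.congr fun n => ?_
  rcases le_total (u n - 1) 0 with hn | hn
  · rw [abs_of_nonpos hn, max_eq_right hn]; ring
  · rw [abs_of_nonneg hn, max_eq_left hn]; ring

/-- For the nearly-unstable scaling `a_n = 1 - ε_n`,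
`β_n = ½(1-δ)ε_n²`, we have `β_n ≤ a_n - 1 - log a_n`, so the map
`x ↦ exp (β_n + a_n (x-1))` has a smallest fixed point `x_n ≥ 1`, and
`ε_n⁻¹ (x_n - 1) → 1 - √δ`. -/
theorem stmt_1 (ε : ℕ → ℝ) (hε : ∀ n, ε n ∈ Set.Ioo (0:ℝ) 1)
    (hε0 : Tendsto ε atTop (nhds 0)) (δ : ℝ) (hδ : δ ∈ Set.Ico (0:ℝ) 1)
    (a β : ℕ → ℝ) (ha : ∀ n, a n = 1 - ε n)
    (hβ : ∀ n, β n = (1 / 2) * (1 - δ) * (ε n) ^ 2) :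
    (∀ n, β n ≤ a n - 1 - Real.log (a n)) ∧
    ∃ x : ℕ → ℝ,
      (∀ n, IsLeast {y : ℝ | 1 ≤ y ∧ Real.exp (β n + a n * (y - 1)) = y} (x n)) ∧
      Tendsto (fun n => (x n - 1) / ε n) atTop (nhds (1 - Real.sqrt δ)) := by
  obtain ⟨hδ0, hδ1⟩ := hδ
  have hineq : ∀ n, β n ≤ a n - 1 - log (a n) := by
    intro n
    have h := sq_half_le_neg_sub_log_one_sub (hε n).1.le (hε n).2
    rw [hβ, ha]
    nlinarith [sq_nonneg (ε n)]
  have hex : ∀ n, ∃ x, IsLeast {y : ℝ | 1 ≤ y ∧ exp (β n + a n * (y - 1)) = y} x ∧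
      x ≤ 1 / a n := by
    intro n
    obtain ⟨h0, h1⟩ := hε n
    have hδ' : 0 ≤ 1 - δ := by linarith
    exact exists_isLeast_exp_fixedPoint (by rw [ha]; linarith) (by rw [ha]; linarith)
      (by rw [hβ]; positivity) (hineq n)
  choose x hx hxa using hex
  refine ⟨hineq, x, hx, ?_⟩
  refine tendsto_one_sub_sqrt_of_sq_tendsto (v := fun n => 1 / (1 - ε n)) ?_ (fun n => ?_) ?_
  · rw [tendsto_iff_norm_sub_tendsto_zero]
    have h14 : Tendsto (fun n => 14 * ε n) atTop (nhds 0) := by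
      simpa using hε0.const_mul 14
    refine squeeze_zero' (Eventually.of_forall fun n => norm_nonneg _) ?_ h14
    filter_upwards [hε0.eventually_le_const (show (0 : ℝ) < 1 / 3 by norm_num)] with n hn
    have hfix := (hx n).1.2
    have hle := hxa n
    rw [hβ, ha] at hfix
    rw [ha] at hle
    exact abs_sq_sub_le_of_exp_fixedPoint (hε n).1 hn (hx n).1.1 hle hfix
  · obtain ⟨h0, h1⟩ := hε n
    have hle := hxa n
    have hpos : 0 < 1 - ε n := by linarith
    rw [ha] at hle
    rw [div_le_iff₀ h0]
    have : 1 / (1 - ε n) * ε n = 1 / (1 - ε n) - 1 := by field_simp; ring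
    linarith
  · simpa using (hε0.const_sub 1).inv₀ (by norm_num)
end

section
/- Let T ≥ 0, let ν be a finite Borel measure on [0,T], and let h ∈ BV[0,T], i.e., h(t) = Dh([0,t]) for all t ∈ [0,T] for some finite signed Borel measure Dh on [0,T]. Then h*ν ∈ BV[0,T] with D(h*ν) = Dh*ν, where (Dh*ν)(A) = ∫∫ 1_A(u+v) Dh(du) ν(dv) restricted to [0,T]; in particular ‖h*ν‖_{BV[0,T]} ≤ ‖h‖_{BV[0,T]} · ν([0,T]). -/
open MeasureTheory

/-- The convolution of a function with a measure:
`(h * ν)(t) = ∫_{[0,t]} h(t-s) ν(ds)`. -/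
noncomputable def mconv (h : ℝ → ℝ) (ν : Measure ℝ) (t : ℝ) : ℝ :=
  ∫ s in Set.Icc 0 t, h (t - s) ∂ν

lemma integrable_measureReal_add_preimage (p ν : Measure ℝ) [IsFiniteMeasure p]
    [IsFiniteMeasure ν] {B : Set ℝ} (hB : MeasurableSet B) :
    Integrable (fun v => p.real ((fun u => u + v) ⁻¹' B)) ν := by
  have hm : MeasurableSet ((fun x : ℝ × ℝ => x.1 + x.2) ⁻¹' B) :=
    (measurable_fst.add measurable_snd) hB
  refine Integrable.of_bound (C := p.real Set.univ)
    (measurable_measure_prodMk_right hm).ennreal_toReal.aestronglyMeasurable ?_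
  filter_upwards with v
  rw [Real.norm_of_nonneg measureReal_nonneg]
  exact measureReal_mono (Set.subset_univ _)

lemma measureReal_conv_eq_integral (p ν : Measure ℝ) [IsFiniteMeasure p] [IsFiniteMeasure ν]
    {B : Set ℝ} (hB : MeasurableSet B) :
    (p.conv ν).real B = ∫ v, p.real ((fun u => u + v) ⁻¹' B) ∂ν := by
  have hadd : Measurable (fun x : ℝ × ℝ => x.1 + x.2) := measurable_fst.add measurable_snd
  have hm : MeasurableSet ((fun x : ℝ × ℝ => x.1 + x.2) ⁻¹' B) := hadd hB
  rw [Measure.conv, measureReal_def, Measure.map_apply hadd hB, Measure.prod_apply_symm hm]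
  exact (integral_toReal (measurable_measure_prodMk_right hm).aemeasurable
    (.of_forall fun v => measure_lt_top _ _)).symm

lemma measure_conv_univ (p ν : Measure ℝ) [IsFiniteMeasure p] [IsFiniteMeasure ν] :
    (p.conv ν) Set.univ = p Set.univ * ν Set.univ := by
  rw [Measure.conv, Measure.map_apply (by fun_prop) .univ,
    Set.preimage_univ, ← Set.univ_prod_univ, Measure.prod_prod]

lemma totalVariation_toSignedMeasure_sub_le (μ ν : Measure ℝ) [IsFiniteMeasure μ]
    [IsFiniteMeasure ν] :
    (μ.toSignedMeasure - ν.toSignedMeasure).totalVariation ≤ μ + ν := by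
  rw [SignedMeasure.totalVariation_eq_variation]
  simpa using VectorMeasure.variation_sub_le (μ := μ.toSignedMeasure) (ν := ν.toSignedMeasure)

lemma signedMeasure_apply_eq_inter_of_compl (D : SignedMeasure ℝ) {K : Set ℝ}
    (hK : MeasurableSet K)
    (hD : ∀ s : Set ℝ, MeasurableSet s → s ⊆ Kᶜ → D s = 0)
    {B : Set ℝ} (hB : MeasurableSet B) : D B = D (B ∩ K) := by
  rw [← Set.inter_union_sdiff B K, VectorMeasure.of_union
    (Set.disjoint_left.2 fun x hx hx' => hx'.2 hx.2) (hB.inter hK) (hB.diff hK),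
    hD (B \ K) (hB.diff hK) fun x hx => hx.2]
  simp

/-- If `h ∈ BV[0,T]`, i.e. `h(t) = Dh([0,t])` for a finite signed
Borel measure `Dh` on `[0,T]`, and `ν` is a finite Borel measure on `[0,T]`, then
`h*ν ∈ BV[0,T]` with representing signed measure `Dh*ν` (the image of `Dh ⊗ ν`
under addition, restricted to `[0,T]`), and
`‖h*ν‖_{BV[0,T]} ≤ ‖h‖_{BV[0,T]} · ν([0,T])`. -/
theorem stmt_3 (T : ℝ) (hT : 0 ≤ T) (ν : Measure ℝ) [IsFiniteMeasure ν]
    (hν : ν (Set.Icc 0 T)ᶜ = 0)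
    (h : ℝ → ℝ) (Dh : SignedMeasure ℝ)
    (hDh : ∀ s : Set ℝ, MeasurableSet s → s ⊆ (Set.Icc 0 T)ᶜ → Dh s = 0)
    (hrep : ∀ t ∈ Set.Icc 0 T, h t = Dh (Set.Icc 0 t)) :
    ∃ D2 : SignedMeasure ℝ,
      (∀ A : Set ℝ, MeasurableSet A →
        D2 A = ∫ v, Dh ((fun u => u + v) ⁻¹' (A ∩ Set.Icc 0 T)) ∂ν) ∧
      (∀ t ∈ Set.Icc 0 T, mconv h ν t = D2 (Set.Icc 0 t)) ∧
      D2.totalVariation Set.univ ≤ Dh.totalVariation Set.univ * ν (Set.Icc 0 T) := by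
  set p := Dh.toJordanDecomposition.posPart
  set n := Dh.toJordanDecomposition.negPart
  set P := (p.conv ν).restrict (Set.Icc 0 T)
  set N := (n.conv ν).restrict (Set.Icc 0 T)
  have hD2 : ∀ A : Set ℝ, MeasurableSet A → (P.toSignedMeasure - N.toSignedMeasure) A =
      ∫ v, Dh ((fun u => u + v) ⁻¹' (A ∩ Set.Icc 0 T)) ∂ν := by
    intro A hA
    have hB : MeasurableSet (A ∩ Set.Icc 0 T) := hA.inter measurableSet_Icc
    rw [Measure.toSignedMeasure_sub_apply hA, measureReal_restrict_apply hA,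
      measureReal_restrict_apply hA, measureReal_conv_eq_integral p ν hB,
      measureReal_conv_eq_integral n ν hB,
      ← integral_sub (integrable_measureReal_add_preimage p ν hB)
        (integrable_measureReal_add_preimage n ν hB)]
    refine integral_congr_ae (.of_forall fun v => ?_)
    exact (Dh.apply_eq_posPart_real_sub_negPart_real ((measurable_add_const v) hB)).symm
  refine ⟨P.toSignedMeasure - N.toSignedMeasure, hD2, fun t ht => ?_, ?_⟩
  · rw [hD2 _ measurableSet_Icc, mconv, ← integral_indicator measurableSet_Icc]
    refine integral_congr_ae ?_
    filter_upwards [compl_mem_ae_iff.2 hν] with v hv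
    rw [Set.mem_compl_iff, Set.notMem_compl_iff] at hv
    have hpre : MeasurableSet ((fun u => u + v) ⁻¹' (Set.Icc 0 t ∩ Set.Icc 0 T)) :=
      (measurable_add_const v) (measurableSet_Icc.inter measurableSet_Icc)
    by_cases hvt : v ≤ t
    · rw [Set.indicator_of_mem (Set.mem_Icc.2 ⟨hv.1, hvt⟩),
        hrep _ ⟨by linarith, by linarith [hv.1, ht.2]⟩,
        signedMeasure_apply_eq_inter_of_compl Dh measurableSet_Icc hDh hpre]
      congr 1
      ext u
      simp only [Set.mem_inter_iff, Set.mem_preimage, Set.mem_Icc]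
      constructor
      · rintro ⟨h1, h2⟩
        refine ⟨⟨⟨?_, ?_⟩, ?_, ?_⟩, ?_, ?_⟩ <;> linarith [hv.1, hv.2, ht.1, ht.2]
      · rintro ⟨⟨⟨_, h2⟩, _⟩, h3, _⟩
        exact ⟨h3, by linarith⟩
    · rw [Set.indicator_of_notMem fun hmem => hvt hmem.2]
      refine (hDh _ hpre fun u hu hu' => hvt ?_).symm
      linarith [hu.1.2, hu'.1]
  · have hνT : ν (Set.Icc 0 T) = ν Set.univ := by
      rw [← measure_add_measure_compl (μ := ν) (measurableSet_Icc (a := 0) (b := T)), hν, add_zero]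
    calc (P.toSignedMeasure - N.toSignedMeasure).totalVariation Set.univ
        ≤ (P + N) Set.univ := totalVariation_toSignedMeasure_sub_le P N Set.univ
      _ ≤ (p.conv ν) Set.univ + (n.conv ν) Set.univ :=
          add_le_add (Measure.restrict_apply_le _ _) (Measure.restrict_apply_le _ _)
      _ = Dh.totalVariation Set.univ * ν (Set.Icc 0 T) := by
          rw [measure_conv_univ, measure_conv_univ, ← add_mul, hνT]
          rfl
end

section
/- Let T ≥ 0, let ν and ν′ be finite Borel measures on [0,T], and let h ∈ BV[0,T]. Then ∫_0^T |(h*ν)(t) − (h*ν′)(t)| dt ≤ ‖h‖_{BV[0,T]} · W¹_T(ν, ν′), where W¹_T(ν, ν′) = ∫_0^T |F_ν(t) − F_{ν′}(t)| dt and F_ν(t) = ν([0,t]). -/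
open MeasureTheory

theorem measurable_real_Icc_const (μ : Measure ℝ) [IsFiniteMeasure μ] (a : ℝ) :
    Measurable fun x => μ.real (Set.Icc a x) :=
  Monotone.measurable fun _ _ hxy => measureReal_mono (Set.Icc_subset_Icc_right hxy)

theorem integrable_real_Icc_sub (μ ν : Measure ℝ) [IsFiniteMeasure μ] [IsFiniteMeasure ν]
    (t : ℝ) : Integrable (fun s => μ.real (Set.Icc 0 (t - s))) ν := by
  refine Integrable.of_bound (C := μ.real Set.univ)
    ((measurable_real_Icc_const μ 0).comp
      (measurable_const.sub measurable_id)).aestronglyMeasurable (.of_forall fun s => ?_)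
  rw [Real.norm_of_nonneg measureReal_nonneg]
  exact measureReal_mono (Set.subset_univ _)

/-- The convolution of the distribution function of `μ` with `ν` is symmetric in `μ` and `ν`. -/
theorem setIntegral_real_Icc_sub_comm (μ ν : Measure ℝ) [IsFiniteMeasure μ] [IsFiniteMeasure ν]
    (t : ℝ) :
    ∫ s in Set.Icc 0 t, μ.real (Set.Icc 0 (t - s)) ∂ν =
      ∫ u in Set.Icc 0 t, ν.real (Set.Icc 0 (t - u)) ∂μ := by
  set S : Set (ℝ × ℝ) := {p | 0 ≤ p.1 ∧ 0 ≤ p.2 ∧ p.1 + p.2 ≤ t} with hS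
  have hSm : MeasurableSet S :=
    (measurableSet_le measurable_const measurable_fst).inter
      ((measurableSet_le measurable_const measurable_snd).inter
        (measurableSet_le (measurable_fst.add measurable_snd) measurable_const))
  have key := integral_integral_swap (μ := ν) (ν := μ)
    (f := fun s u => S.indicator (fun _ => (1 : ℝ)) (s, u))
    ((integrable_const (1 : ℝ)).indicator hSm)
  have section_eq (κ : Measure ℝ) (s : ℝ) (f : ℝ → ℝ)
      (hf : f = (if 0 ≤ s then Set.Icc 0 (t - s) else ∅).indicator fun _ => (1 : ℝ)) :
      ∫ u, f u ∂κ = (Set.Icc 0 t).indicator (fun s => κ.real (Set.Icc 0 (t - s))) s := by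
    subst hf
    by_cases hs : 0 ≤ s
    · rw [if_pos hs, integral_indicator measurableSet_Icc]
      by_cases hst : s ≤ t
      · simp [hs, hst]
      · simp [hst]
    · simp [hs]
  rw [← integral_indicator measurableSet_Icc, ← integral_indicator measurableSet_Icc]
  convert key using 2
  · ext s
    refine (section_eq μ s _ ?_).symm
    ext u
    by_cases hs : 0 ≤ s <;> simp [hS, Set.indicator_apply, hs, le_sub_iff_add_le']
  · ext u
    refine (section_eq ν u _ ?_).symm
    ext s
    by_cases hu : 0 ≤ u <;> simp [hS, Set.indicator_apply, hu, le_sub_iff_add_le]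

theorem mconv_eq_sub_of_eq_signedMeasure_Icc {T : ℝ} (ν : Measure ℝ) [IsFiniteMeasure ν]
    {h : ℝ → ℝ} {Dh : SignedMeasure ℝ} (hrep : ∀ t ∈ Set.Icc 0 T, h t = Dh (Set.Icc 0 t))
    {t : ℝ} (ht : t ≤ T) :
    mconv h ν t =
      ∫ u in Set.Icc 0 t, ν.real (Set.Icc 0 (t - u)) ∂Dh.toJordanDecomposition.posPart -
      ∫ u in Set.Icc 0 t, ν.real (Set.Icc 0 (t - u)) ∂Dh.toJordanDecomposition.negPart := by
  rw [setIntegral_real_Icc_sub_comm ν, setIntegral_real_Icc_sub_comm ν,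
    ← integral_sub (integrable_real_Icc_sub _ _ t) (integrable_real_Icc_sub _ _ t)]
  refine setIntegral_congr_fun measurableSet_Icc fun s hs => ?_
  have hts : t - s ∈ Set.Icc 0 T := ⟨by linarith [hs.2], by linarith [hs.1]⟩
  simp only [hrep _ hts]
  exact Dh.apply_eq_posPart_real_sub_negPart_real measurableSet_Icc

/-- If `h ∈ BV[0,T]` (with representing finite signed measure `Dh`)
and `ν, ν'` are finite Borel measures on `[0,T]`, then
`∫₀ᵀ |(h*ν)(t) − (h*ν')(t)| dt ≤ ‖h‖_{BV[0,T]} · W¹_T(ν,ν')`, where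
`W¹_T(ν,ν') = ∫₀ᵀ |ν([0,t]) − ν'([0,t])| dt`. -/
theorem stmt_4 (T : ℝ) (hT : 0 ≤ T)
    (ν ν' : Measure ℝ) [IsFiniteMeasure ν] [IsFiniteMeasure ν']
    (hν : ν (Set.Icc 0 T)ᶜ = 0) (hν' : ν' (Set.Icc 0 T)ᶜ = 0)
    (h : ℝ → ℝ) (Dh : SignedMeasure ℝ)
    (hDh : ∀ s : Set ℝ, MeasurableSet s → s ⊆ (Set.Icc 0 T)ᶜ → Dh s = 0)
    (hrep : ∀ t ∈ Set.Icc 0 T, h t = Dh (Set.Icc 0 t)) :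
    ∫ t in Set.Icc 0 T, |mconv h ν t - mconv h ν' t| ≤
      (Dh.totalVariation Set.univ).toReal *
        ∫ t in Set.Icc 0 T, |(ν (Set.Icc 0 t)).toReal - (ν' (Set.Icc 0 t)).toReal| := by
  set P := Dh.toJordanDecomposition.posPart
  set N := Dh.toJordanDecomposition.negPart
  have hV : Dh.totalVariation = P + N := rfl
  rw [hV]
  set G : ℝ → ℝ := fun x => ν.real (Set.Icc 0 x) - ν'.real (Set.Icc 0 x) with hG
  change _ ≤ (P + N).real Set.univ * ∫ t in Set.Icc 0 T, |G t|
  have hGm : Measurable G :=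
    (measurable_real_Icc_const ν 0).sub (measurable_real_Icc_const ν' 0)
  have hGneg (x : ℝ) (hx : x < 0) : G x = 0 := by simp [hG, hx]
  have hGb (x : ℝ) : |G x| ≤ ν.real Set.univ + ν'.real Set.univ := by
    have h1 : ν.real (Set.Icc 0 x) ≤ ν.real Set.univ := measureReal_mono (Set.subset_univ _)
    have h2 : ν'.real (Set.Icc 0 x) ≤ ν'.real Set.univ := measureReal_mono (Set.subset_univ _)
    have h3 : 0 ≤ ν.real (Set.Icc 0 x) := measureReal_nonneg
    have h4 : 0 ≤ ν'.real (Set.Icc 0 x) := measureReal_nonneg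
    exact abs_le.2 ⟨by simp only [hG]; linarith, by simp only [hG]; linarith⟩
  have hGint (κ : Measure ℝ) [IsFiniteMeasure κ] (t : ℝ) :
      Integrable (fun u => |G (t - u)|) κ :=
    ((integrable_real_Icc_sub ν κ t).sub (integrable_real_Icc_sub ν' κ t)).abs
  have hGabs : Integrable (fun t => |G t|) (volume.restrict (Set.Icc 0 T)) :=
    Integrable.of_bound hGm.abs.aestronglyMeasurable _
      (.of_forall fun x => by simpa using hGb x)
  have hprod : Integrable (Function.uncurry fun t u => |G (t - u)|)
      ((volume.restrict (Set.Icc 0 T)).prod ((P + N).restrict (Set.Ici 0))) :=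
    Integrable.of_bound
      (hGm.comp (measurable_fst.sub measurable_snd)).abs.aestronglyMeasurable _
      (.of_forall fun p => by simpa [Function.uncurry] using hGb (p.1 - p.2))
  have hpoint (t : ℝ) (ht : t ∈ Set.Icc 0 T) :
      |mconv h ν t - mconv h ν' t| ≤ ∫ u in Set.Ici 0, |G (t - u)| ∂(P + N) := by
    have hle (κ : Measure ℝ) [IsFiniteMeasure κ] :
        |∫ u in Set.Icc 0 t, G (t - u) ∂κ| ≤ ∫ u in Set.Ici 0, |G (t - u)| ∂κ :=
      abs_integral_le_integral_abs.trans <|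
        setIntegral_mono_set (hGint _ t) (.of_forall fun _ => abs_nonneg _)
          (.of_forall Set.Icc_subset_Ici_self)
    have hsub (κ : Measure ℝ) [IsFiniteMeasure κ] :
        ∫ u in Set.Icc 0 t, G (t - u) ∂κ =
          ∫ u in Set.Icc 0 t, ν.real (Set.Icc 0 (t - u)) ∂κ -
            ∫ u in Set.Icc 0 t, ν'.real (Set.Icc 0 (t - u)) ∂κ :=
      integral_sub (integrable_real_Icc_sub _ _ t) (integrable_real_Icc_sub _ _ t)
    rw [mconv_eq_sub_of_eq_signedMeasure_Icc ν hrep ht.2,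
      mconv_eq_sub_of_eq_signedMeasure_Icc ν' hrep ht.2, sub_sub_sub_comm, ← hsub P, ← hsub N,
      Measure.restrict_add, integral_add_measure (hGint _ t) (hGint _ t)]
    exact (abs_sub _ _).trans (add_le_add (hle P) (hle N))
  have hshift (u : ℝ) (hu : 0 ≤ u) :
      ∫ t in Set.Icc 0 T, |G (t - u)| ≤ ∫ t in Set.Icc 0 T, |G t| := by
    rw [← integral_indicator measurableSet_Icc, ← integral_indicator measurableSet_Icc,
      ← integral_sub_right_eq_self ((Set.Icc 0 T).indicator fun t => |G t|) u]
    refine integral_mono_of_nonneg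
      (.of_forall fun t => Set.indicator_nonneg (fun _ _ => abs_nonneg _) t)
      (((integrable_indicator_iff measurableSet_Icc).2 hGabs).comp_sub_right u)
      (.of_forall fun t => ?_)
    by_cases ht : t ∈ Set.Icc 0 T
    · simp only [Set.indicator_of_mem ht]
      by_cases htu : t - u < 0
      · rw [hGneg _ htu, abs_zero]
        exact Set.indicator_nonneg (fun _ _ => abs_nonneg _) _
      · have htu' : t - u ∈ Set.Icc 0 T := ⟨not_lt.1 htu, by linarith [ht.2]⟩
        rw [Set.indicator_of_mem htu']
    · simp only [Set.indicator_of_notMem ht]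
      exact Set.indicator_nonneg (fun _ _ => abs_nonneg _) _
  calc ∫ t in Set.Icc 0 T, |mconv h ν t - mconv h ν' t|
      ≤ ∫ t in Set.Icc 0 T, ∫ u in Set.Ici 0, |G (t - u)| ∂(P + N) :=
        integral_mono_of_nonneg (.of_forall fun _ => abs_nonneg _) hprod.integral_prod_left
          (ae_restrict_of_forall_mem measurableSet_Icc hpoint)
    _ = ∫ u in Set.Ici 0, (∫ t in Set.Icc 0 T, |G (t - u)|) ∂(P + N) :=
        integral_integral_swap hprod
    _ ≤ ∫ _ in Set.Ici 0, (∫ t in Set.Icc 0 T, |G t|) ∂(P + N) :=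
        integral_mono_of_nonneg
          (.of_forall fun _ => integral_nonneg fun _ => abs_nonneg _) (integrable_const _)
          (ae_restrict_of_forall_mem measurableSet_Ici hshift)
    _ = (P + N).real (Set.Ici 0) * ∫ t in Set.Icc 0 T, |G t| := by
        rw [setIntegral_const, smul_eq_mul]
    _ ≤ (P + N).real Set.univ * ∫ t in Set.Icc 0 T, |G t| :=
        mul_le_mul_of_nonneg_right (measureReal_mono (Set.subset_univ _))
          (integral_nonneg fun _ => abs_nonneg _)
end

section
/- Let ν₁ and ν₂ be Borel probability measures on [0,∞) and let T ≥ 0. Then ∫_0^T |F_{ν₁}(t) − F_{ν₂}(t)| dt, where F_{ν_i}(t) = ν_i([0,t]), equals the infimum over all Borel probability measures γ on [0,∞) × [0,∞) whose first marginal is ν₁ and whose second marginal is ν₂ of ∫ |min(x,T) − min(y,T)| γ(dx,dy); moreover, this infimum is attained by some such coupling γ. -/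
open MeasureTheory

namespace WassersteinLine

open ProbabilityTheory Set Filter Topology

/-- The lower quantile function of a measure on the real line. -/
noncomputable def quantile (ν : Measure ℝ) (u : ℝ) : ℝ :=
  sInf {x | u ≤ cdf ν x}

lemma quantile_le_iff (ν : Measure ℝ) {u : ℝ} (hu : u ∈ Ioo (0 : ℝ) 1) (x : ℝ) :
    quantile ν u ≤ x ↔ u ≤ cdf ν x := by
  have hne : {x | u ≤ cdf ν x}.Nonempty :=
    ((tendsto_cdf_atTop ν).eventually (eventually_ge_nhds hu.2)).exists
  have hbdd : BddBelow {x | u ≤ cdf ν x} := by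
    obtain ⟨b, hb⟩ := ((tendsto_cdf_atBot ν).eventually (eventually_lt_nhds hu.1)).exists
    refine ⟨b, fun y hy => ?_⟩
    by_contra! h
    exact absurd (hy.trans (monotone_cdf ν h.le)) (not_le.2 hb)
  refine ⟨fun h => ?_, fun h => csInf_le hbdd h⟩
  refine le_trans ?_ (monotone_cdf ν h)
  have hc : Tendsto (cdf ν) (𝓝[>] quantile ν u) (𝓝 (cdf ν (quantile ν u))) :=
    ((cdf ν).right_continuous _).mono_left (nhdsWithin_mono _ Ioi_subset_Ici_self)
  refine ge_of_tendsto hc ?_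
  filter_upwards [self_mem_nhdsWithin] with y hy
  obtain ⟨s, hs, hsy⟩ := exists_lt_of_csInf_lt hne hy
  exact le_trans hs (monotone_cdf ν hsy.le)

lemma aemeasurable_quantile (ν : Measure ℝ) :
    AEMeasurable (quantile ν) (volume.restrict (Ioo (0 : ℝ) 1)) := by
  refine aemeasurable_restrict_of_monotoneOn measurableSet_Ioo fun u hu v hv huv => ?_
  rw [quantile_le_iff ν hu]
  exact huv.trans ((quantile_le_iff ν hv _).1 le_rfl)

instance isProbabilityMeasure_volume_Ioo_zero_one :
    IsProbabilityMeasure (volume.restrict (Ioo (0 : ℝ) 1)) :=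
  ⟨by simp⟩

lemma map_quantile (ν : Measure ℝ) [IsProbabilityMeasure ν] :
    (volume.restrict (Ioo (0 : ℝ) 1)).map (quantile ν) = ν := by
  have := Measure.isProbabilityMeasure_map (aemeasurable_quantile ν)
  refine Measure.ext_of_Iic _ _ fun t => ?_
  rw [Measure.map_apply_of_aemeasurable (aemeasurable_quantile ν) measurableSet_Iic,
    Measure.restrict_apply' measurableSet_Ioo, ← ofReal_cdf ν t]
  have hset : quantile ν ⁻¹' Iic t ∩ Ioo 0 1 = Iic (cdf ν t) ∩ Ioo 0 1 := by
    ext u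
    exact and_congr_left fun hu => quantile_le_iff ν hu t
  rw [hset]
  have hae : (Iic (cdf ν t) ∩ Ioo 0 1 : Set ℝ) =ᵐ[volume] (Ioc 0 (cdf ν t) : Set ℝ) := by
    have h1 : ∀ᵐ u : ℝ, u ≠ 1 := by simp [ae_iff]
    filter_upwards [h1] with u hu
    refine propext ⟨fun h => ⟨h.2.1, h.1⟩, fun h => ⟨h.2, h.1, ?_⟩⟩
    exact lt_of_le_of_ne (h.2.trans (cdf_le_one ν t)) hu
  rw [measure_congr hae, Real.volume_Ioc, sub_zero]

/-- The comonotone coupling of two measures on the real line. -/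
noncomputable def quantileCoupling (ν₁ ν₂ : Measure ℝ) : Measure (ℝ × ℝ) :=
  (volume.restrict (Ioo (0 : ℝ) 1)).map fun u => (quantile ν₁ u, quantile ν₂ u)

instance isProbabilityMeasure_quantileCoupling (ν₁ ν₂ : Measure ℝ) :
    IsProbabilityMeasure (quantileCoupling ν₁ ν₂) :=
  Measure.isProbabilityMeasure_map
    ((aemeasurable_quantile ν₁).prodMk (aemeasurable_quantile ν₂))

lemma map_fst_quantileCoupling (ν₁ ν₂ : Measure ℝ) [IsProbabilityMeasure ν₁] :
    (quantileCoupling ν₁ ν₂).map Prod.fst = ν₁ := by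
  rw [quantileCoupling, AEMeasurable.map_map_of_aemeasurable measurable_fst.aemeasurable
    ((aemeasurable_quantile ν₁).prodMk (aemeasurable_quantile ν₂))]
  exact map_quantile ν₁

lemma map_snd_quantileCoupling (ν₁ ν₂ : Measure ℝ) [IsProbabilityMeasure ν₂] :
    (quantileCoupling ν₁ ν₂).map Prod.snd = ν₂ := by
  rw [quantileCoupling, AEMeasurable.map_map_of_aemeasurable measurable_snd.aemeasurable
    ((aemeasurable_quantile ν₁).prodMk (aemeasurable_quantile ν₂))]
  exact map_quantile ν₂

/-- The difference of the indicators of `p.1 ≤ t` and `p.2 ≤ t`. -/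
noncomputable def indicatorDiff (t : ℝ) (p : ℝ × ℝ) : ℝ :=
  (Iic t).indicator 1 p.1 - (Iic t).indicator 1 p.2

lemma abs_indicatorDiff_le (t : ℝ) (p : ℝ × ℝ) : |indicatorDiff t p| ≤ 1 := by
  simp only [indicatorDiff, indicator_apply, Pi.one_apply]
  split_ifs <;> norm_num

lemma measurable_uncurry_indicatorDiff :
    Measurable fun q : (ℝ × ℝ) × ℝ => indicatorDiff q.2 q.1 := by
  simp only [indicatorDiff, indicator_apply, Pi.one_apply, mem_Iic]
  refine Measurable.sub ?_ ?_ <;>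
    refine Measurable.ite (measurableSet_le (by fun_prop) (by fun_prop)) ?_ ?_ <;>
    exact measurable_const

lemma integrable_abs_indicatorDiff (γ : Measure (ℝ × ℝ)) [IsFiniteMeasure γ] (T : ℝ) :
    Integrable (fun q : (ℝ × ℝ) × ℝ => |indicatorDiff q.2 q.1|)
      (γ.prod (volume.restrict (Icc 0 T))) :=
  Integrable.of_bound measurable_uncurry_indicatorDiff.abs.aestronglyMeasurable 1
    (ae_of_all _ fun q => by simpa using abs_indicatorDiff_le q.2 q.1)

lemma setIntegral_abs_indicatorDiff {T : ℝ} (hT : 0 ≤ T) {p : ℝ × ℝ}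
    (h₁ : 0 ≤ p.1) (h₂ : 0 ≤ p.2) :
    ∫ t in Icc 0 T, |indicatorDiff t p| = |min p.1 T - min p.2 T| := by
  obtain ⟨x, y⟩ := p
  simp only at h₁ h₂ ⊢
  wlog hxy : x ≤ y generalizing x y
  · rw [abs_sub_comm, ← this y x h₂ h₁ (le_of_not_ge hxy)]
    simp only [indicatorDiff, abs_sub_comm]
  have hfun : (fun t => |indicatorDiff t (x, y)|) = (Ico x y).indicator 1 := by
    ext t
    simp only [indicatorDiff, indicator_apply, Pi.one_apply, mem_Iic, mem_Ico]
    grind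
  rw [hfun, integral_Icc_eq_integral_Ico, integral_indicator_one measurableSet_Ico,
    measureReal_restrict_apply measurableSet_Ico, Ico_inter_Ico, Real.volume_real_Ico]
  grind

lemma integral_abs_min_sub_min {T : ℝ} (hT : 0 ≤ T) (γ : Measure (ℝ × ℝ))
    [IsFiniteMeasure γ] (h₁ : ∀ᵐ p ∂γ, 0 ≤ p.1) (h₂ : ∀ᵐ p ∂γ, 0 ≤ p.2) :
    ∫ p, |min p.1 T - min p.2 T| ∂γ = ∫ t in Icc 0 T, ∫ p, |indicatorDiff t p| ∂γ := by
  rw [← integral_integral_swap (f := fun p t => |indicatorDiff t p|)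
    (integrable_abs_indicatorDiff γ T)]
  refine integral_congr_ae ?_
  filter_upwards [h₁, h₂] with p hp₁ hp₂
  exact (setIntegral_abs_indicatorDiff hT hp₁ hp₂).symm

lemma integral_indicatorDiff (γ : Measure (ℝ × ℝ)) [IsFiniteMeasure γ] (t : ℝ) :
    ∫ p, indicatorDiff t p ∂γ =
      (γ.map Prod.fst).real (Iic t) - (γ.map Prod.snd).real (Iic t) := by
  have hi (f : ℝ × ℝ → ℝ) (hf : Measurable f) :
      Integrable ((f ⁻¹' Iic t).indicator (1 : ℝ × ℝ → ℝ)) γ :=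
    (integrable_const 1).indicator (hf measurableSet_Iic)
  rw [map_measureReal_apply measurable_fst measurableSet_Iic,
    map_measureReal_apply measurable_snd measurableSet_Iic,
    ← integral_indicator_one (measurable_fst measurableSet_Iic),
    ← integral_indicator_one (measurable_snd measurableSet_Iic),
    ← integral_sub (hi _ measurable_fst) (hi _ measurable_snd)]
  rfl

lemma integral_abs_indicatorDiff_quantileCoupling (ν₁ ν₂ : Measure ℝ) (t : ℝ) :
    ∫ p, |indicatorDiff t p| ∂(quantileCoupling ν₁ ν₂) =
      |∫ p, indicatorDiff t p ∂(quantileCoupling ν₁ ν₂)| := by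
  have hm : Measurable (indicatorDiff t) :=
    measurable_uncurry_indicatorDiff.comp (measurable_id.prodMk measurable_const)
  have hq := (aemeasurable_quantile ν₁).prodMk (aemeasurable_quantile ν₂)
  rw [quantileCoupling, integral_map hq hm.aestronglyMeasurable,
    integral_map hq hm.abs.aestronglyMeasurable]
  have hd : ∀ u ∈ Ioo (0 : ℝ) 1, indicatorDiff t (quantile ν₁ u, quantile ν₂ u) =
      (Iic (cdf ν₁ t)).indicator 1 u - (Iic (cdf ν₂ t)).indicator 1 u := fun u hu => by
    simp only [indicatorDiff, indicator_apply, mem_Iic, quantile_le_iff _ hu, Pi.one_apply]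
  rw [setIntegral_congr_fun measurableSet_Ioo hd,
    setIntegral_congr_fun measurableSet_Ioo fun u hu => congrArg abs (hd u hu)]
  generalize cdf ν₁ t = a
  generalize cdf ν₂ t = b
  wlog hab : b ≤ a generalizing a b
  · simp_rw [abs_sub_comm (indicator (Iic a) _ _)]
    rw [this b a (le_of_not_ge hab), ← abs_neg, ← integral_neg]
    simp_rw [neg_sub]
  have hnonneg (u : ℝ) : (0 : ℝ) ≤ (Iic a).indicator 1 u - (Iic b).indicator 1 u :=
    sub_nonneg.2 (indicator_le_indicator_of_subset (Iic_subset_Iic.2 hab)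
      (fun _ => zero_le_one) u)
  rw [abs_of_nonneg (integral_nonneg hnonneg)]
  simp_rw [abs_of_nonneg (hnonneg _)]

lemma measureReal_Icc_zero {ν : Measure ℝ} (hν : ν (Iio 0) = 0) (t : ℝ) :
    (ν (Icc 0 t)).toReal = ν.real (Iic t) := by
  have h : ∀ᵐ x ∂ν, (0 : ℝ) ≤ x := by simpa [ae_iff, Iio_def] using hν
  refine congrArg ENNReal.toReal (measure_congr ?_)
  filter_upwards [h] with x hx
  exact propext ⟨fun h => h.2, fun h => ⟨hx, h⟩⟩

lemma ae_nonneg_of_map {α : Type*} [MeasurableSpace α] {γ : Measure α} {f : α → ℝ}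
    (hf : Measurable f) (h : γ.map f (Iio 0) = 0) : ∀ᵐ p ∂γ, 0 ≤ f p := by
  rw [Measure.map_apply hf measurableSet_Iio] at h
  simpa [ae_iff, preimage, Iio] using h

end WassersteinLine

open WassersteinLine

/-- For probability measures `ν₁, ν₂` on `[0,∞)` and `T ≥ 0`, the
truncated Wasserstein distance `∫₀ᵀ |F_{ν₁}(t) − F_{ν₂}(t)| dt` equals the
infimum over couplings `γ` of `ν₁` and `ν₂` of `∫ |min(x,T) − min(y,T)| γ(dx,dy)`,
and this infimum is attained. -/
theorem stmt_5 (T : ℝ) (hT : 0 ≤ T)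
    (ν₁ ν₂ : Measure ℝ) [IsProbabilityMeasure ν₁] [IsProbabilityMeasure ν₂]
    (hν₁ : ν₁ (Set.Iio 0) = 0) (hν₂ : ν₂ (Set.Iio 0) = 0) :
    (∃ γ : Measure (ℝ × ℝ), IsProbabilityMeasure γ ∧
        γ.map Prod.fst = ν₁ ∧ γ.map Prod.snd = ν₂ ∧
        ∫ p : ℝ × ℝ, |min p.1 T - min p.2 T| ∂γ =
          ∫ t in Set.Icc 0 T,
            |(ν₁ (Set.Icc 0 t)).toReal - (ν₂ (Set.Icc 0 t)).toReal|) ∧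
    (∀ γ : Measure (ℝ × ℝ), IsProbabilityMeasure γ →
        γ.map Prod.fst = ν₁ → γ.map Prod.snd = ν₂ →
        (∫ t in Set.Icc 0 T,
            |(ν₁ (Set.Icc 0 t)).toReal - (ν₂ (Set.Icc 0 t)).toReal|) ≤
          ∫ p : ℝ × ℝ, |min p.1 T - min p.2 T| ∂γ) := by
  have hF (γ : Measure (ℝ × ℝ)) [IsProbabilityMeasure γ] (h₁ : γ.map Prod.fst = ν₁)
      (h₂ : γ.map Prod.snd = ν₂) (t : ℝ) :
      |(ν₁ (Set.Icc 0 t)).toReal - (ν₂ (Set.Icc 0 t)).toReal| =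
        |∫ p, indicatorDiff t p ∂γ| := by
    rw [integral_indicatorDiff, h₁, h₂, measureReal_Icc_zero hν₁, measureReal_Icc_zero hν₂]
  have hC (γ : Measure (ℝ × ℝ)) [IsProbabilityMeasure γ] (h₁ : γ.map Prod.fst = ν₁)
      (h₂ : γ.map Prod.snd = ν₂) :=
    integral_abs_min_sub_min hT γ (ae_nonneg_of_map measurable_fst (h₁ ▸ hν₁))
      (ae_nonneg_of_map measurable_snd (h₂ ▸ hν₂))
  refine ⟨⟨quantileCoupling ν₁ ν₂, inferInstance, map_fst_quantileCoupling ν₁ ν₂,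
    map_snd_quantileCoupling ν₁ ν₂, ?_⟩, fun γ _ h₁ h₂ => ?_⟩
  · have h₁ := map_fst_quantileCoupling ν₁ ν₂
    have h₂ := map_snd_quantileCoupling ν₁ ν₂
    rw [hC _ h₁ h₂]
    simp_rw [hF _ h₁ h₂, integral_abs_indicatorDiff_quantileCoupling]
  · rw [hC γ h₁ h₂]
    simp_rw [hF γ h₁ h₂]
    exact integral_mono_of_nonneg (Filter.Eventually.of_forall fun _ => abs_nonneg _)
      (integrable_abs_indicatorDiff γ T).integral_prod_right
      (Filter.Eventually.of_forall fun _ => abs_integral_le_integral_abs)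
end

section
/- Let (c_n)_{n≥1} be a sequence of nonnegative real numbers satisfying c₁ ≤ 1 and c_n ≤ Σ_{i=1}^{n−1} c_i c_{n−i} for every n ≥ 2. Then c_n ≤ C_{n−1} for every n ≥ 1, where C_k denotes the k-th Catalan number. -/
/-- If `c₁ ≤ 1`, `c_n ≥ 0` and `c_n ≤ Σ_{i=1}^{n−1} c_i c_{n−i}`
for `n ≥ 2`, then `c_n ≤ C_{n−1}` where `C_k` is the `k`-th Catalan number. -/
theorem stmt_12 (c : ℕ → ℝ)
    (hnonneg : ∀ n, 1 ≤ n → 0 ≤ c n)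
    (h1 : c 1 ≤ 1)
    (hrec : ∀ n, 2 ≤ n → c n ≤ ∑ i ∈ Finset.Ico 1 n, c i * c (n - i)) :
    ∀ n, 1 ≤ n → c n ≤ (catalan (n - 1) : ℝ) := by
  intro n
  induction n using Nat.strong_induction_on with
  | _ n ih =>
    intro hn
    obtain rfl | hn2 : n = 1 ∨ 2 ≤ n := by omega
    · simpa using h1
    obtain ⟨m, rfl⟩ := Nat.exists_eq_add_of_le' hn2
    calc c (m + 2) ≤ ∑ i ∈ Finset.Ico 1 (m + 2), c i * c (m + 2 - i) := hrec _ hn2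
      _ ≤ ∑ i ∈ Finset.Ico 1 (m + 2), (catalan (i - 1) : ℝ) * catalan (m + 2 - i - 1) := by
        refine Finset.sum_le_sum fun i hi => ?_
        rw [Finset.mem_Ico] at hi
        exact mul_le_mul (ih i (by omega) (by omega)) (ih _ (by omega) (by omega))
          (hnonneg _ (by omega)) (Nat.cast_nonneg _)
      _ = ∑ i ∈ Finset.range (m + 1), (catalan i : ℝ) * catalan (m - i) := by
        rw [Finset.sum_Ico_eq_sum_range]
        refine Finset.sum_congr rfl fun i _ => ?_
        rw [Nat.add_sub_cancel_left, show m + 2 - (1 + i) - 1 = m - i by omega]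
      _ = (catalan (m + 2 - 1) : ℝ) := by
        rw [show m + 2 - 1 = m + 1 by omega, catalan_succ, Finset.sum_range]
        push_cast
        rfl
end

section
/- Let α ∈ (0,1] and T > 0. There exist constants 0 < c ≤ C such that for all r, s with 0 < r < s ≤ T: c · B_α(r,s) ≤ ∫_0^r (r−u)^{α−1}(s−u)^{α−1} u^α du ≤ C · B_α(r,s), where B_α(r,s) = r^{2α} s^{α−1} (1 − r/s)^{2α−1} if α < 1/2, B_α(r,s) = r^{2α} s^{α−1} (1 − log(1 − r/s)) if α = 1/2, and B_α(r,s) = r^{2α} s^{α−1} if α > 1/2. -/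
open Real

/-- The comparison kernel `B_α(r,s)` for `0 < r < s`. -/
noncomputable def Bkernel (α r s : ℝ) : ℝ :=
  r ^ (2 * α) * s ^ (α - 1) *
    (if α < 1 / 2 then (1 - r / s) ^ (2 * α - 1)
     else if α = 1 / 2 then 1 - Real.log (1 - r / s)
     else 1)

/-- The integrand after rescaling to the unit interval by `u = r (1 - y)`, with `ε = 1 - r / s`. -/
noncomputable def rescaledIntegrand (α ε y : ℝ) : ℝ :=
  (1 - y) ^ α * y ^ (α - 1) * (ε + (1 - ε) * y) ^ (α - 1)

lemma rescaledIntegrand_nonneg {α ε y : ℝ} (hε : 0 < ε) (hε1 : ε < 1) (hy : 0 ≤ y) (hy1 : y ≤ 1) :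
    0 ≤ rescaledIntegrand α ε y := by
  have h1 : 0 ≤ 1 - y := by linarith
  have h2 : 0 ≤ 1 - ε := by linarith
  unfold rescaledIntegrand
  positivity

lemma rescaledIntegrand_le {α ε y δ : ℝ} (hα : 0 < α) (hα1 : α ≤ 1) (hy : 0 ≤ y) (hy1 : y ≤ 1)
    (hδ : 0 < δ) (h : δ ≤ ε + (1 - ε) * y) :
    rescaledIntegrand α ε y ≤ δ ^ (α - 1) * y ^ (α - 1) := by
  have h1 : (1 - y) ^ α ≤ 1 := rpow_le_one (by linarith) (by linarith) hα.le
  have h2 : (ε + (1 - ε) * y) ^ (α - 1) ≤ δ ^ (α - 1) :=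
    rpow_le_rpow_of_nonpos hδ h (by linarith)
  have h3 : 0 ≤ y ^ (α - 1) := rpow_nonneg hy _
  have h4 : 0 ≤ (ε + (1 - ε) * y) ^ (α - 1) := rpow_nonneg (hδ.le.trans h) _
  calc (1 - y) ^ α * y ^ (α - 1) * (ε + (1 - ε) * y) ^ (α - 1)
      ≤ 1 * y ^ (α - 1) * δ ^ (α - 1) := by gcongr
    _ = δ ^ (α - 1) * y ^ (α - 1) := by ring

lemma le_rescaledIntegrand {α ε y δ : ℝ} (hα1 : α ≤ 1) (hε : 0 < ε) (hε1 : ε < 1)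
    (hy : 0 ≤ y) (hy1 : y ≤ 1 / 2) (h : ε + y ≤ δ ∨ 1 ≤ δ) :
    1 / 2 * (δ ^ (α - 1) * y ^ (α - 1)) ≤ rescaledIntegrand α ε y := by
  have h0 : 0 < ε + (1 - ε) * y := by
    have : 0 ≤ (1 - ε) * y := mul_nonneg (by linarith) hy
    linarith
  have hδ : ε + (1 - ε) * y ≤ δ := by rcases h with h | h <;> nlinarith
  have h1 : 1 / 2 ≤ (1 - y) ^ α := by
    calc (1 / 2 : ℝ) ≤ (1 - y) ^ (1 : ℝ) := by rw [rpow_one]; linarith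
      _ ≤ (1 - y) ^ α := rpow_le_rpow_of_exponent_ge (by linarith) (by linarith) hα1
  have h2 : δ ^ (α - 1) ≤ (ε + (1 - ε) * y) ^ (α - 1) :=
    rpow_le_rpow_of_nonpos h0 hδ (by linarith)
  have h3 : 0 ≤ y ^ (α - 1) := rpow_nonneg hy _
  have h4 : 0 ≤ δ ^ (α - 1) := rpow_nonneg (h0.le.trans hδ) _
  calc 1 / 2 * (δ ^ (α - 1) * y ^ (α - 1)) = 1 / 2 * y ^ (α - 1) * δ ^ (α - 1) := by ring
    _ ≤ (1 - y) ^ α * y ^ (α - 1) * (ε + (1 - ε) * y) ^ (α - 1) := by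
        gcongr

lemma intervalIntegrable_rescaledIntegrand {α ε : ℝ} (hα : 0 < α) (hα1 : α ≤ 1) (hε : 0 < ε)
    (hε1 : ε < 1) {a b : ℝ} (ha : 0 ≤ a) (hab : a ≤ b) (hb : b ≤ 1) :
    IntervalIntegrable (rescaledIntegrand α ε) MeasureTheory.volume a b := by
  have hg : IntervalIntegrable (fun y : ℝ => ε ^ (α - 1) * y ^ (α - 1)) MeasureTheory.volume a b :=
    (intervalIntegral.intervalIntegrable_rpow' (by linarith)).const_mul _
  refine hg.mono_fun (by unfold rescaledIntegrand; fun_prop) ?_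
  rw [Set.uIoc_of_le hab]
  filter_upwards [MeasureTheory.ae_restrict_mem measurableSet_Ioc] with y hy
  have hy0 : 0 ≤ y := ha.trans hy.1.le
  have hy1 : y ≤ 1 := hy.2.trans hb
  rw [norm_of_nonneg (rescaledIntegrand_nonneg hε hε1 hy0 hy1),
    norm_of_nonneg (mul_nonneg (rpow_nonneg hε.le _) (rpow_nonneg hy0 _))]
  exact rescaledIntegrand_le hα hα1 hy0 hy1 hε (by nlinarith)

lemma integral_rescaledIntegrand_le {α ε : ℝ} (hα : 0 < α) (hα1 : α ≤ 1) (hε : 0 < ε)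
    (hε1 : ε < 1) :
    ∫ y in (0 : ℝ)..1, rescaledIntegrand α ε y ≤
      ε ^ (2 * α - 1) / α + ∫ y in ε..1, y ^ (2 * α - 2) := by
  have hi1 := intervalIntegrable_rescaledIntegrand hα hα1 hε hε1 le_rfl hε.le hε1.le
  have hi2 := intervalIntegrable_rescaledIntegrand hα hα1 hε hε1 hε.le hε1.le le_rfl
  rw [← intervalIntegral.integral_add_adjacent_intervals hi1 hi2]
  apply add_le_add
  · have h : ∫ y in (0 : ℝ)..ε, ε ^ (α - 1) * y ^ (α - 1) = ε ^ (2 * α - 1) / α := by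
      rw [intervalIntegral.integral_const_mul, integral_rpow (Or.inl (by linarith)),
        sub_add_cancel, zero_rpow hα.ne', sub_zero, ← mul_div_assoc, ← rpow_add hε]
      ring_nf
    rw [← h]
    refine intervalIntegral.integral_mono_on hε.le hi1
      ((intervalIntegral.intervalIntegrable_rpow' (by linarith)).const_mul _) fun y hy => ?_
    exact rescaledIntegrand_le hα hα1 hy.1 (hy.2.trans hε1.le) hε (by nlinarith [hy.1])
  · refine intervalIntegral.integral_mono_on hε1.le hi2
      (intervalIntegral.intervalIntegrable_rpow (Or.inr ?_)) fun y hy => ?_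
    · rw [Set.uIcc_of_le hε1.le]
      exact fun h => h.1.not_gt hε
    · have hy0 : 0 < y := hε.trans_le hy.1
      have := rescaledIntegrand_le (ε := ε) hα hα1 hy0.le hy.2 hy0 (by nlinarith [hy.2])
      rwa [← rpow_add hy0, show α - 1 + (α - 1) = 2 * α - 2 by ring] at this

lemma integral_le_integral_rescaledIntegrand {α ε : ℝ} (hα : 0 < α) (hα1 : α ≤ 1) (hε : 0 < ε)
    (hε1 : ε < 1) {a b : ℝ} (ha : 0 ≤ a) (hab : a ≤ b) (hb : b ≤ 1) {f : ℝ → ℝ}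
    (hf : IntervalIntegrable f MeasureTheory.volume a b)
    (h : ∀ y ∈ Set.Icc a b, f y ≤ rescaledIntegrand α ε y) :
    ∫ y in a..b, f y ≤ ∫ y in (0 : ℝ)..1, rescaledIntegrand α ε y := by
  refine (intervalIntegral.integral_mono_on hab hf
    (intervalIntegrable_rescaledIntegrand hα hα1 hε hε1 ha hab hb) h).trans ?_
  refine intervalIntegral.integral_mono_interval ha hab hb ?_
    (intervalIntegrable_rescaledIntegrand hα hα1 hε hε1 le_rfl zero_le_one le_rfl)
  filter_upwards [MeasureTheory.ae_restrict_mem measurableSet_Ioc] with y hy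
  exact rescaledIntegrand_nonneg hε hε1 hy.1.le hy.2

lemma one_fourth_le_integral_rescaledIntegrand {α ε : ℝ} (hα : 0 < α) (hα1 : α ≤ 1) (hε : 0 < ε)
    (hε1 : ε < 1) : 1 / 4 ≤ ∫ y in (0 : ℝ)..1, rescaledIntegrand α ε y := by
  have h := integral_le_integral_rescaledIntegrand (a := 0) (b := 1 / 2)
    (f := fun y => 1 / 2 * (1 ^ (α - 1) * y ^ (α - 1))) hα hα1 hε hε1 le_rfl
    (by norm_num) (by norm_num)
    (((intervalIntegral.intervalIntegrable_rpow' (by linarith)).const_mul _).const_mul _)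
    (fun y hy => le_rescaledIntegrand hα1 hε hε1 hy.1 hy.2 (Or.inr le_rfl))
  refine le_trans ?_ h
  rw [intervalIntegral.integral_const_mul, intervalIntegral.integral_const_mul, one_rpow,
    integral_rpow (Or.inl (by linarith)), sub_add_cancel, zero_rpow hα.ne', sub_zero, one_mul]
  have h1 : (1 / 2 : ℝ) ≤ (1 / 2) ^ α := by
    simpa using rpow_le_rpow_of_exponent_ge (x := (1 / 2 : ℝ)) (by norm_num) (by norm_num) hα1
  have h2 : (1 / 2 : ℝ) ≤ (1 / 2) ^ α / α := by
    rw [le_div_iff₀ hα]; linarith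
  linarith

lemma rpow_le_integral_rescaledIntegrand {α ε : ℝ} (hα : 0 < α) (hα1 : α ≤ 1) (hε : 0 < ε)
    (hε1 : ε < 1) :
    1 / 8 * ε ^ (2 * α - 1) ≤ ∫ y in (0 : ℝ)..1, rescaledIntegrand α ε y := by
  have h := integral_le_integral_rescaledIntegrand (a := 0) (b := ε / 2)
    (f := fun y => 1 / 2 * ((2 * ε) ^ (α - 1) * y ^ (α - 1))) hα hα1 hε hε1 le_rfl
    (by linarith) (by linarith)
    (((intervalIntegral.intervalIntegrable_rpow' (by linarith)).const_mul _).const_mul _)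
    (fun y hy => le_rescaledIntegrand hα1 hε hε1 hy.1 (by linarith [hy.2])
      (Or.inl (by linarith [hy.2])))
  refine le_trans ?_ h
  rw [intervalIntegral.integral_const_mul, intervalIntegral.integral_const_mul,
    integral_rpow (Or.inl (by linarith)), sub_add_cancel, zero_rpow hα.ne', sub_zero,
    mul_rpow two_pos.le hε.le, div_rpow hε.le two_pos.le,
    show 2 * α - 1 = (α - 1) + α by ring, rpow_add hε, rpow_sub two_pos, rpow_one]
  have h2 : (0 : ℝ) < 2 ^ α := by positivity
  have h3 : 0 < ε ^ (α - 1) * ε ^ α := by positivity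
  calc 1 / 8 * (ε ^ (α - 1) * ε ^ α) ≤ 1 / 4 * (ε ^ (α - 1) * ε ^ α) / α := by
        rw [le_div_iff₀ hα]; nlinarith
    _ = _ := by field_simp; norm_num

lemma neg_log_le_integral_rescaledIntegrand {ε : ℝ} (hε : 0 < ε) (hε1 : ε < 1) :
    1 / 4 * -log ε ≤ ∫ y in (0 : ℝ)..1, rescaledIntegrand (1 / 2) ε y := by
  have h0 : (0 : ℝ) ∉ Set.uIcc (ε / 2) (1 / 2) := by
    rw [Set.uIcc_of_le (by linarith)]
    exact fun h => by linarith [h.1]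
  have h := integral_le_integral_rescaledIntegrand (α := 1 / 2) (a := ε / 2) (b := 1 / 2)
    (f := fun y => 1 / 4 * y⁻¹) (by norm_num) (by norm_num) hε hε1
    (by linarith) (by linarith) (by norm_num)
    ((intervalIntegral.intervalIntegrable_inv (fun y hy => ne_of_mem_of_not_mem hy h0)
      continuousOn_id).const_mul _)
    (fun y hy => by
      have hy0 : 0 < y := by linarith [hy.1]
      refine le_trans ?_ (le_rescaledIntegrand (δ := 4 * y) (by norm_num) hε hε1
        hy0.le hy.2 (Or.inl (by linarith [hy.1])))
      rw [mul_rpow (by norm_num) hy0.le, mul_assoc, ← rpow_add hy0,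
        show (4 : ℝ) = 2 ^ (2 : ℝ) by norm_num, ← rpow_mul two_pos.le]
      norm_num [rpow_neg_one]
      linarith)
  refine le_trans (le_of_eq ?_) h
  rw [intervalIntegral.integral_const_mul, integral_inv h0, ← log_inv]
  congr 2
  field_simp

lemma setIntegral_eq_mul_integral_rescaledIntegrand {α r s : ℝ} (hr : 0 < r) (hrs : r < s) :
    ∫ u in Set.Ioo 0 r, (r - u) ^ (α - 1) * (s - u) ^ (α - 1) * u ^ α =
      r ^ (2 * α) * s ^ (α - 1) * ∫ y in (0 : ℝ)..1, rescaledIntegrand α (1 - r / s) y := by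
  have hs : 0 < s := hr.trans hrs
  rw [← MeasureTheory.integral_Ioc_eq_integral_Ioo, ← intervalIntegral.integral_of_le hr.le]
  have h := intervalIntegral.integral_comp_sub_mul (a := 0) (b := 1)
    (fun u => (r - u) ^ (α - 1) * (s - u) ^ (α - 1) * u ^ α) hr.ne' r
  simp only [mul_one, sub_self, mul_zero, sub_zero, smul_eq_mul] at h
  rw [eq_inv_mul_iff_mul_eq₀ hr.ne'] at h
  rw [← h, ← intervalIntegral.integral_const_mul, ← intervalIntegral.integral_const_mul]
  refine intervalIntegral.integral_congr fun y hy => ?_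
  rw [Set.uIcc_of_le zero_le_one] at hy
  have h1 : 0 ≤ 1 - y := by linarith [hy.2]
  have h2 : 0 ≤ 1 - r / s := by rw [sub_nonneg, div_le_one hs]; exact hrs.le
  have h3 : 0 ≤ 1 - r / s + (1 - (1 - r / s)) * y := by
    rw [sub_sub_cancel]
    have := hy.1
    positivity
  have e : s - (r - r * y) = s * (1 - r / s + (1 - (1 - r / s)) * y) := by
    field_simp
    ring
  simp only [rescaledIntegrand]
  rw [e, show r - (r - r * y) = r * y by ring, show r - r * y = r * (1 - y) by ring,
    mul_rpow hr.le hy.1, mul_rpow hs.le h3, mul_rpow hr.le h1,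
    show 2 * α = 1 + (α - 1) + α by ring, rpow_add hr, rpow_add hr, rpow_one]
  ring

/-- The singular factor of `Bkernel`, as a function of `ε = 1 - r / s`. -/
noncomputable def singularFactor (α ε : ℝ) : ℝ :=
  if α < 1 / 2 then ε ^ (2 * α - 1) else if α = 1 / 2 then 1 - log ε else 1

lemma exists_singularFactor_bounds {α : ℝ} (hα : 0 < α) (hα1 : α ≤ 1) :
    ∃ C : ℝ, 1 ≤ C ∧ ∀ ε : ℝ, 0 < ε → ε < 1 →
      1 / 8 * singularFactor α ε ≤ ∫ y in (0 : ℝ)..1, rescaledIntegrand α ε y ∧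
      ∫ y in (0 : ℝ)..1, rescaledIntegrand α ε y ≤ C * singularFactor α ε := by
  have hα' : 1 ≤ 1 / α := by rw [le_div_iff₀ hα]; linarith
  have hint : ∀ ε : ℝ, 0 < ε → ε < 1 → α ≠ 1 / 2 →
      ∫ y in ε..1, y ^ (2 * α - 2) = (1 - ε ^ (2 * α - 1)) / (2 * α - 1) := by
    intro ε hε hε1 hne
    rw [integral_rpow (Or.inr ⟨fun h => hne (by linarith), ?_⟩), one_rpow,
      show 2 * α - 2 + 1 = 2 * α - 1 by ring]
    rw [Set.uIcc_of_le hε1.le]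
    exact fun h => h.1.not_gt hε
  rcases lt_trichotomy α (1 / 2) with h | rfl | h
  · have hd : 0 < 1 - 2 * α := by linarith
    refine ⟨1 / α + 1 / (1 - 2 * α), by linarith [one_div_pos.2 hd], fun ε hε hε1 => ?_⟩
    rw [singularFactor, if_pos h]
    refine ⟨rpow_le_integral_rescaledIntegrand hα hα1 hε hε1,
      (integral_rescaledIntegrand_le hα hα1 hε hε1).trans ?_⟩
    rw [hint ε hε hε1 h.ne, ← neg_div_neg_eq (1 - ε ^ (2 * α - 1)), neg_sub, neg_sub, add_mul, one_div_mul_eq_div,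
      one_div_mul_eq_div]
    gcongr
    linarith
  · refine ⟨2, by norm_num, fun ε hε hε1 => ?_⟩
    rw [singularFactor, if_neg (lt_irrefl _), if_pos rfl]
    have hlog : log ε < 0 := log_neg hε hε1
    refine ⟨?_, (integral_rescaledIntegrand_le hα hα1 hε hε1).trans ?_⟩
    · linarith [one_fourth_le_integral_rescaledIntegrand hα hα1 hε hε1,
        neg_log_le_integral_rescaledIntegrand hε hε1]
    · have h0 : (0 : ℝ) ∉ Set.uIcc ε 1 := by
        rw [Set.uIcc_of_le hε1.le]
        exact fun h => h.1.not_gt hε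
      have e : ∫ y in ε..1, y ^ (2 * (1 / 2 : ℝ) - 2) = -log ε := by
        rw [show 2 * (1 / 2 : ℝ) - 2 = -1 by norm_num]
        simp only [rpow_neg_one]
        rw [integral_inv h0, one_div, log_inv]
      rw [e]
      norm_num
      linarith
  · have hd : 0 < 2 * α - 1 := by linarith
    refine ⟨1 / α + 1 / (2 * α - 1), by linarith [one_div_pos.2 hd], fun ε hε hε1 => ?_⟩
    rw [singularFactor, if_neg h.not_gt, if_neg h.ne']
    refine ⟨by linarith [one_fourth_le_integral_rescaledIntegrand hα hα1 hε hε1],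
      (integral_rescaledIntegrand_le hα hα1 hε hε1).trans ?_⟩
    rw [hint ε hε hε1 h.ne', mul_one]
    have h0 : 0 ≤ ε ^ (2 * α - 1) := rpow_nonneg hε.le _
    have h1 : ε ^ (2 * α - 1) ≤ 1 := rpow_le_one hε.le hε1.le hd.le
    gcongr
    linarith

/-- For `α ∈ (0,1]` and `T > 0` there are constants
`0 < c ≤ C` such that for all `0 < r < s ≤ T`,
`c·B_α(r,s) ≤ ∫₀ʳ (r−u)^{α−1}(s−u)^{α−1}u^α du ≤ C·B_α(r,s)`. -/
theorem stmt_18 (α : ℝ) (hα : α ∈ Set.Ioc (0:ℝ) 1) (T : ℝ) (hT : 0 < T) :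
    ∃ c C : ℝ, 0 < c ∧ c ≤ C ∧
      ∀ r s : ℝ, 0 < r → r < s → s ≤ T →
        c * Bkernel α r s ≤
            (∫ u in Set.Ioo 0 r, (r - u) ^ (α - 1) * (s - u) ^ (α - 1) * u ^ α) ∧
          (∫ u in Set.Ioo 0 r, (r - u) ^ (α - 1) * (s - u) ^ (α - 1) * u ^ α) ≤
            C * Bkernel α r s := by
  obtain ⟨C, hC, h⟩ := exists_singularFactor_bounds hα.1 hα.2
  refine ⟨1 / 8, C, by norm_num, by linarith, fun r s hr hrs _ => ?_⟩
  have hs : 0 < s := hr.trans hrs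
  obtain ⟨hl, hu⟩ := h (1 - r / s) (by rw [sub_pos, div_lt_one hs]; exact hrs)
    (by linarith [div_pos hr hs])
  have hB : Bkernel α r s = r ^ (2 * α) * s ^ (α - 1) * singularFactor α (1 - r / s) := rfl
  rw [hB, setIntegral_eq_mul_integral_rescaledIntegrand hr hrs, mul_left_comm, mul_left_comm C]
  constructor <;> gcongr
end
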